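/- Let ℓ be a prime, X a finite group and Y a normal subgroup of X. Let ξ ∈ Irr(Y) with ξ(1)_ℓ = |Y : Z(Y)|_ℓ and such that every element of ℓ-power order of Z(Y) belongs to Z(X), and let χ ∈ Irr(X) lying over ξ (i.e. ⟨Res_Y χ, ξ⟩ ≠ 0) with χ(1)_ℓ = |X : Z(X)|_ℓ and |X_ξ|_ℓ = |Y·Z(X)|_ℓ. Then the multiplicity ⟨Res_Y χ, ξ⟩ is prime to ℓ. (The character-theoretic content of Proposition 5.1.5(c).) -/

import Mathlib

open CategoryTheory

/-- The inertia subgroup `X_ξ` of a function `ξ` on a normal subgroup `Y` of `X`: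
the set of `x ∈ X` such that `ξ (x⁻¹ y x) = ξ y` for all `y ∈ Y`. -/
def inertia {X : Type*} [Group X] (Y : Subgroup X) [hN : Y.Normal] {α : Type*}
    (ξ : ↥Y → α) : Subgroup X where
  carrier := {x : X | ∀ y z : ↥Y, (z : X) = x⁻¹ * y * x → ξ z = ξ y}
  one_mem' := by
    intro y z hz
    have hzy : z = y := Subtype.ext (by simpa using hz)
    rw [hzy]
  mul_mem' := by
    intro a b ha hb y z hz
    have hw : a⁻¹ * (y : X) * a ∈ Y := by
      simpa using hN.conj_mem (y : X) y.2 a⁻¹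
    have h1 : ξ ⟨a⁻¹ * (y : X) * a, hw⟩ = ξ y := ha y ⟨a⁻¹ * (y : X) * a, hw⟩ rfl
    have h2 : ξ z = ξ ⟨a⁻¹ * (y : X) * a, hw⟩ := by
      refine hb _ z ?_
      show (z : X) = b⁻¹ * (a⁻¹ * (y : X) * a) * b
      rw [hz]; group
    rw [h2, h1]
  inv_mem' := by
    intro x hx y z hz
    exact (hx z y (by rw [hz]; group)).symm

/-- Schur lemma for a linear endomorphism commuting with the action. -/
theorem FDRep.exists_eq_smul_id_of_commute {G : Type} [Monoid G] (V : FDRep ℂ G) [Simple V]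
    (f : V →ₗ[ℂ] V) (hf : ∀ g, f ∘ₗ V.ρ g = V.ρ g ∘ₗ f) : ∃ c : ℂ, f = c • LinearMap.id := by
  let F : V ⟶ V := ⟨InducedCategory.homMk (ModuleCat.ofHom f), fun g ↦ by
    ext v
    exact LinearMap.congr_fun (hf g) v⟩
  obtain ⟨c, hc⟩ := endomorphism_simple_eq_smul_id ℂ F
  refine ⟨c, ?_⟩
  have h := congrArg (fun T : V ⟶ V ↦ T.hom.hom.hom) hc
  exact h.symm

theorem FDRep.finrank_pos_of_simple {G : Type} [Monoid G] (V : FDRep ℂ G) [Simple V] :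
    0 < Module.finrank ℂ V := by
  by_contra h
  have h0 : Module.finrank ℂ V = 0 := by omega
  have : Subsingleton V := Module.finrank_zero_iff.mp h0
  apply id_nonzero V
  ext v
  exact Subsingleton.elim _ _

theorem ordProj_card_eq_of_le {G : Type*} [Group G] [Finite G] {ℓ : ℕ} (hℓ : ℓ.Prime)
    {A C : Subgroup G} (hAC : A ≤ C) (h : ∀ z ∈ C, (∃ n : ℕ, z ^ ℓ ^ n = 1) → z ∈ A) :
    ordProj[ℓ] (Nat.card A) = ordProj[ℓ] (Nat.card C) := by
  have := Fact.mk hℓ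
  apply Nat.dvd_antisymm
  · exact Nat.ordProj_dvd_ordProj_of_dvd Nat.card_pos.ne' (Subgroup.card_dvd_of_le hAC) ℓ
  · obtain ⟨P⟩ : Nonempty (Sylow ℓ C) := inferInstance
    rw [← hℓ.pow_dvd_iff_dvd_ordProj Nat.card_pos.ne', ← P.card_eq_multiplicity,
      ← Subgroup.card_map_of_injective C.subtype_injective]
    apply Subgroup.card_dvd_of_le
    rintro _ ⟨z, hz, rfl⟩
    obtain ⟨n, hn⟩ := P.isPGroup' ⟨z, hz⟩
    exact h _ z.2 ⟨n, by simpa using congrArg (fun t : P ↦ ((t : C) : G)) hn⟩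

theorem Subgroup.card_sup_mul_card_inf {G : Type*} [Group G] (H K : Subgroup G) [H.Normal] :
    Nat.card ↥(H ⊔ K) * Nat.card ↥(H ⊓ K) = Nat.card H * Nat.card K := by
  have h1 := relIndex_mul_relIndex ⊥ H (H ⊔ K) bot_le le_sup_left
  have h2 := relIndex_mul_relIndex ⊥ (H ⊓ K) K bot_le inf_le_right
  simp only [relIndex_bot_left, relIndex_sup_left, inf_relIndex_right] at h1 h2
  rw [← h1, ← h2]
  ring

/-- The representation of a normal subgroup `Y` conjugate to `W` by `x`. -/
noncomputable def FDRep.conj {X : Type} [Group X] {Y : Subgroup X} [Y.Normal] (W : FDRep ℂ Y)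
    (x : X) : FDRep ℂ Y :=
  FDRep.of (V := W) (W.ρ.comp (MulAut.conjNormal x : MulAut Y).toMonoidHom)

theorem FDRep.character_conj {X : Type} [Group X] {Y : Subgroup X} [Y.Normal] (W : FDRep ℂ Y)
    (x : X) (y : Y) : (W.conj x).character y = W.character (MulAut.conjNormal x y) :=
  rfl

instance FDRep.simple_conj {X : Type} [Group X] {Y : Subgroup X} [Y.Normal] [Finite Y]
    (W : FDRep ℂ Y) [Simple W] (x : X) : Simple (W.conj x) := by
  have := Fintype.ofFinite Y
  rw [FDRep.simple_iff_char_is_norm_one, ← (FDRep.simple_iff_char_is_norm_one W).mp ‹_›]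
  simp only [FDRep.character_conj, map_inv]
  exact Equiv.sum_comp (MulAut.conjNormal x : MulAut Y).toEquiv
    fun y ↦ W.character y * W.character y⁻¹

theorem mem_inertia_iff {X : Type*} [Group X] {Y : Subgroup X} [Y.Normal] {α : Type*}
    {ξ : Y → α} {x : X} : x ∈ inertia Y ξ ↔ ∀ y, ξ (MulAut.conjNormal x y) = ξ y := by
  rw [← inv_mem_iff]
  constructor
  · intro h y
    exact h y _ (by simp)
  · intro h y z hz
    rw [← h y]
    congr 1
    ext
    simpa using hz

open scoped Classical in
theorem FDRep.sum_character_conj_mul_character_inv {X : Type} [Group X] {Y : Subgroup X}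
    [Y.Normal] [Fintype Y] (W : FDRep ℂ Y) [Simple W] (x : X) :
    ∑ y : Y, W.character (MulAut.conjNormal x y) * W.character y⁻¹ =
      if x ∈ inertia Y W.character then (Nat.card Y : ℂ) else 0 := by
  split_ifs with h
  · rw [mem_inertia_iff] at h
    simp only [h]
    exact (FDRep.simple_iff_char_is_norm_one W).mp ‹_›
  · have hc : (Nat.card Y : ℂ) ≠ 0 := Nat.cast_ne_zero.mpr Nat.card_pos.ne'
    let := invertibleOfNonzero hc
    have key := FDRep.char_orthonormal (W.conj x) W
    rw [if_neg] at key
    · simpa [hc, FDRep.character_conj] using key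
    · rintro ⟨i⟩
      exact h (mem_inertia_iff.mpr fun y ↦ congrFun (FDRep.char_iso i) y)

/-- The degree formula of Clifford theory. -/
theorem FDRep.card_inertia_mul_finrank {X : Type} [Group X] [Fintype X] {Y : Subgroup X}
    [Y.Normal] [Fintype Y] (V : FDRep ℂ X) [Simple V] (W : FDRep ℂ Y) [Simple W] {m : ℕ}
    (hm : ∑ y : Y, V.character (y : X) * W.character y⁻¹ = Nat.card Y * m) (hm0 : m ≠ 0) :
    Nat.card (inertia Y W.character) * Module.finrank ℂ V =
      Nat.card X * m * Module.finrank ℂ W := by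
  classical
  have hY : (Nat.card Y : ℂ) ≠ 0 := Nat.cast_ne_zero.mpr Nat.card_pos.ne'
  let E : Module.End ℂ V := ∑ y : Y, W.character y⁻¹ • V.ρ y
  let S : Module.End ℂ V := ∑ x : X, V.ρ x⁻¹ * E * V.ρ x
  have hS (g : X) : S * V.ρ g = V.ρ g * S := by
    simp only [S, Finset.sum_mul, Finset.mul_sum]
    rw [← Equiv.sum_comp (Equiv.mulRight g) fun x ↦ V.ρ g * (V.ρ x⁻¹ * E * V.ρ x)]
    refine Finset.sum_congr rfl fun x _ ↦ ?_
    simp only [Equiv.coe_mulRight, mul_inv_rev, map_mul, ← mul_assoc]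
    simp [← map_mul]
  obtain ⟨c, hc⟩ := V.exists_eq_smul_id_of_commute S hS
  have htrE : LinearMap.trace ℂ V E = Nat.card Y * m := by
    rw [← hm]
    simp only [E, map_sum, map_smul, smul_eq_mul]
    exact Finset.sum_congr rfl fun y _ ↦ mul_comm _ _
  have htr : c * Module.finrank ℂ V = Nat.card X * (Nat.card Y * m) := by
    have h := congrArg (LinearMap.trace ℂ V) hc
    rw [map_smul, LinearMap.trace_id, smul_eq_mul] at h
    rw [← h]
    simp only [S, map_sum]
    rw [Finset.sum_congr rfl (g := fun _ ↦ (Nat.card Y * m : ℂ))]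
    · simp
    · intro x _
      rw [LinearMap.trace_mul_cycle, ← map_mul, mul_inv_cancel, map_one, one_mul, htrE]
  obtain ⟨f, hf0, hf⟩ : ∃ f : W →ₗ[ℂ] V, f ≠ 0 ∧ ∀ y : Y, f ∘ₗ W.ρ y = V.ρ y ∘ₗ f := by
    let := invertibleOfNonzero hY
    let R : FDRep ℂ Y := FDRep.of (V := V) (V.ρ.comp Y.subtype)
    have key := FDRep.scalar_product_char_eq_finrank_equivariant W R
    have hR : ∑ y : Y, R.character y * W.character y⁻¹ = Nat.card Y * m := hm
    rw [hR, inv_mul_cancel_left₀ hY, Nat.cast_inj] at key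
    have : Nontrivial (W ⟶ R) := Module.nontrivial_of_finrank_pos (R := ℂ) (by omega)
    obtain ⟨F, hF⟩ := exists_ne (0 : W ⟶ R)
    refine ⟨F.hom.hom.hom, fun h ↦ hF ?_, fun y ↦ ?_⟩
    · ext v
      exact LinearMap.congr_fun h v
    · exact congrArg (fun T : W.V ⟶ R.V ↦ T.hom.hom) (F.comm y)
  have hd : (Module.finrank ℂ W : ℂ) ≠ 0 := Nat.cast_ne_zero.mpr W.finrank_pos_of_simple.ne'
  let T (x : X) : Module.End ℂ W :=
    ∑ y : Y, W.character (MulAut.conjNormal x y)⁻¹ • W.ρ y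
  have hT (x : X) : T x = ((if x ∈ inertia Y W.character then (Nat.card Y : ℂ) else 0) /
      Module.finrank ℂ W) • LinearMap.id := by
    obtain ⟨d, hd'⟩ := W.exists_eq_smul_id_of_commute (T x) fun g ↦ by
      change T x * W.ρ g = W.ρ g * T x
      simp only [T, Finset.sum_mul, Finset.mul_sum]
      rw [← Equiv.sum_comp (MulAut.conj g).toEquiv]
      refine Finset.sum_congr rfl fun y _ ↦ ?_
      rw [smul_mul_assoc, mul_smul_comm, ← map_mul, ← map_mul]
      congr 1
      · simp only [MulEquiv.toEquiv_eq_coe, MulEquiv.coe_toEquiv, MulAut.conj_apply, map_mul,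
          map_inv, mul_inv_rev, inv_inv]
        rw [← mul_assoc, FDRep.char_conj]
      · simp [mul_assoc]
    rw [hd']
    congr 1
    rw [eq_div_iff hd, ← W.sum_character_conj_mul_character_inv x]
    have h := congrArg (LinearMap.trace ℂ W) hd'
    rw [map_smul, LinearMap.trace_id, smul_eq_mul] at h
    rw [← h, ← Equiv.sum_comp (Equiv.inv Y)]
    simp only [T, map_sum, map_smul, smul_eq_mul, Equiv.inv_apply, map_inv, inv_inv]
    rfl
  have hSf (w : W) : S (f w) = f ((∑ x, T x) w) := by
    rw [LinearMap.sum_apply, LinearMap.sum_apply, map_sum]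
    refine Finset.sum_congr rfl fun x _ ↦ ?_
    simp only [T, E, Finset.mul_sum, Finset.sum_mul, LinearMap.sum_apply, map_sum]
    rw [← Equiv.sum_comp (MulAut.conjNormal x : MulAut Y).toEquiv]
    refine Finset.sum_congr rfl fun y _ ↦ ?_
    rw [LinearMap.smul_apply, map_smul, ← LinearMap.comp_apply f, hf, mul_smul_comm,
      smul_mul_assoc, ← map_mul, ← map_mul, LinearMap.smul_apply, LinearMap.comp_apply]
    simp [mul_assoc]
  have hcW : c * Module.finrank ℂ W = Nat.card (inertia Y W.character) * Nat.card Y := by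
    obtain ⟨w, hw⟩ : ∃ w, f w ≠ 0 := by
      by_contra! h
      exact hf0 (LinearMap.ext h)
    have h := hSf w
    simp only [hc, hT, ← Finset.sum_smul] at h
    simp only [LinearMap.smul_apply, LinearMap.id_apply, map_smul] at h
    have h := smul_left_injective ℂ hw h
    rw [h, ← Finset.sum_div, div_mul_cancel₀ _ hd, ← Finset.sum_filter, Finset.sum_const,
      nsmul_eq_mul, Nat.card_eq_fintype_card (α := inertia Y W.character), Fintype.card_subtype]
  have h : (Nat.card (inertia Y W.character) * Module.finrank ℂ V : ℂ) =
      Nat.card X * m * Module.finrank ℂ W :=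
    mul_right_cancel₀ hY (by linear_combination Module.finrank ℂ W * htr - Module.finrank ℂ V * hcW)
  exact_mod_cast h

/-- Proposition 5.1.5(c) (character-theoretic form). Let `ℓ` be a prime, `Y ⊴ X` finite
groups, `ξ` the character of an irreducible complex representation `W` of `Y` with
`ξ(1)_ℓ = |Y : Z(Y)|_ℓ` such that every element of `ℓ`-power order of `Z(Y)` lies in
`Z(X)`, and `χ` the character of an irreducible complex representation `V` of `X` lying
over `ξ` (the multiplicity `m ≠ 0`), with `χ(1)_ℓ = |X : Z(X)|_ℓ` and
`|X_ξ|_ℓ = |Y ⬝ Z(X)|_ℓ`.  Then the multiplicity `m` is prime to `ℓ`. -/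
theorem stmt4 {X : Type} [Group X] [Fintype X] (Y : Subgroup X) [Y.Normal] [Fintype ↥Y]
    (ℓ : ℕ) (hℓ : ℓ.Prime)
    (V : FDRep ℂ X) [Simple V] (W : FDRep ℂ ↥Y) [Simple W]
    (hdegξ : ordProj[ℓ] (Module.finrank ℂ W) = ordProj[ℓ] (Subgroup.center ↥Y).index)
    (hZ : ∀ z : ↥Y, z ∈ Subgroup.center ↥Y → (∃ n : ℕ, z ^ ℓ ^ n = 1) →
        (z : X) ∈ Subgroup.center X)
    (m : ℕ)
    (hm : (m : ℂ) =
      (Fintype.card ↥Y : ℂ)⁻¹ * ∑ y : ↥Y, V.character (y : X) * W.character y⁻¹)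
    (hm0 : m ≠ 0)
    (hdegχ : ordProj[ℓ] (Module.finrank ℂ V) = ordProj[ℓ] (Subgroup.center X).index)
    (hcard : ordProj[ℓ] (Nat.card ↥(inertia Y W.character)) =
      ordProj[ℓ] (Nat.card ↥(Y ⊔ Subgroup.center X))) :
    ¬ ℓ ∣ m := by
  have hm' : ∑ y : Y, V.character (y : X) * W.character y⁻¹ = Nat.card Y * m := by
    have hY : (Fintype.card Y : ℂ) ≠ 0 := Nat.cast_ne_zero.mpr Fintype.card_ne_zero
    rw [hm, Nat.card_eq_fintype_card, mul_inv_cancel_left₀ hY]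
  have hdeg := FDRep.card_inertia_mul_finrank V W hm' hm0
  have hZℓ : ordProj[ℓ] (Nat.card ↥(Y ⊓ Subgroup.center X)) =
      ordProj[ℓ] (Nat.card (Subgroup.center Y)) := by
    rw [← ordProj_card_eq_of_le hℓ (A := (Subgroup.center X).subgroupOf Y) (fun z hz ↦
      Subgroup.mem_center_iff.mpr fun y ↦ Subtype.ext (Subgroup.mem_center_iff.mp hz y)) hZ,
      ← Subgroup.inf_subgroupOf_left,
      Nat.card_congr (Subgroup.subgroupOfEquivOfLe inf_le_left).toEquiv]
  have hsup := Subgroup.card_sup_mul_card_inf Y (Subgroup.center X)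
  have hX := (Subgroup.center X).card_mul_index
  have hY := (Subgroup.center Y).card_mul_index
  have hV0 := V.finrank_pos_of_simple.ne'
  have hW0 := W.finrank_pos_of_simple.ne'
  have hcard0 (G : Type) [Group G] [Finite G] : Nat.card G ≠ 0 := Nat.card_pos.ne'
  have hindex0 (G : Type) [Group G] [Finite G] (H : Subgroup G) : H.index ≠ 0 :=
    H.index_ne_zero_of_finite
  have hinj {a b : ℕ} (h : ordProj[ℓ] a = ordProj[ℓ] b) :
      a.factorization ℓ = b.factorization ℓ := Nat.pow_right_injective hℓ.two_le h
  have hfac {a b : ℕ} (ha : a ≠ 0) (hb : b ≠ 0) :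
      (a * b).factorization ℓ = a.factorization ℓ + b.factorization ℓ := by
    rw [Nat.factorization_mul ha hb, Finsupp.add_apply]
  have e1 := congrArg (fun n : ℕ ↦ n.factorization ℓ) hdeg
  have e2 := congrArg (fun n : ℕ ↦ n.factorization ℓ) hsup
  have e3 := congrArg (fun n : ℕ ↦ n.factorization ℓ) hX
  have e4 := congrArg (fun n : ℕ ↦ n.factorization ℓ) hY
  simp only [hfac (hcard0 _) hV0, hfac (mul_ne_zero (hcard0 X) hm0) hW0,
    hfac (hcard0 X) hm0, hfac (hcard0 _) (hcard0 _), hfac (hcard0 _) (hindex0 _ _)] at e1 e2 e3 e4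
  have f1 := hinj hdegξ
  have f2 := hinj hdegχ
  have f3 := hinj hcard
  have f4 := hinj hZℓ
  intro hdvd
  have := (hℓ.factorization_pos_of_dvd hm0 hdvd)
  omega
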